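/- Let H = {0, 89, 178, 267, 356, 445, 534} ⊆ ℤ/623ℤ and let B = {0, 1, 4, 340, 434, 443, 471, 505} ⊆ ℤ/623ℤ. Then H is a subgroup of ℤ/623ℤ of order 7, and the eleven difference sets Δ(8ⁱ·B) for i = 0, 1, …, 10 are pairwise disjoint, each has cardinality 56, each is disjoint from H, and their union together with H \ {0} is (ℤ/623ℤ) \ {0}. -/

import Mathlib

/-- The set of differences `ΔB = {a - c : a, c ∈ B, a ≠ c}`. -/
def diffSet (B : Finset (ZMod 623)) : Finset (ZMod 623) :=
  ((B ×ˢ B).filter fun p => p.1 ≠ p.2).image fun p => p.1 - p.2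

/-- The subgroup block `H = {0, 89, 178, 267, 356, 445, 534}` of `ℤ/623ℤ`. -/
def Hblock : Finset (ZMod 623) := {0, 89, 178, 267, 356, 445, 534}

/-- The base block `B`. -/
def baseBlock : Finset (ZMod 623) := {0, 1, 4, 340, 434, 443, 471, 505}

/-- The dilates `8ⁱ · B` of the base block, for `i = 0, 1, …, 10`. -/
def dilate (i : Fin 11) : Finset (ZMod 623) :=
  baseBlock.image fun x => (8 : ZMod 623) ^ (i : ℕ) * x

theorem mem_Hblock_iff : ∀ x : ZMod 623, x ∈ Hblock ↔ 7 * x = 0 := by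
  decide +kernel

theorem eight_pow_eleven : (8 : ZMod 623) ^ 11 = 1 := by
  decide +kernel

theorem isUnit_eight_pow (n : ℕ) : IsUnit ((8 : ZMod 623) ^ n) :=
  (IsUnit.of_pow_eq_one eight_pow_eleven (by norm_num)).pow n

theorem card_diffSet_baseBlock : (diffSet baseBlock).card = 56 := by
  decide +kernel

theorem disjoint_diffSet_baseBlock_Hblock : Disjoint (diffSet baseBlock) Hblock := by
  decide +kernel

/-- The eleventh power separates the cosets of the subgroup generated by `8`. -/
theorem injOn_pow_eleven : Set.InjOn (· ^ 11 : ZMod 623 → ZMod 623) (diffSet baseBlock) := by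
  refine Finset.card_image_iff.mp (Eq.trans ?_ card_diffSet_baseBlock.symm)
  decide +kernel

theorem eight_pow_mul_injective {d : ZMod 623} (hd : d ∈ diffSet baseBlock) {i j : Fin 11}
    (h : (8 : ZMod 623) ^ (i : ℕ) * d = 8 ^ (j : ℕ) * d) : i = j := by
  have hper : Function.IsPeriodicPt (8 * · : ZMod 623 → ZMod 623) 11 d := by
    rw [Function.IsPeriodicPt, Function.IsFixedPt, mul_left_iterate, eight_pow_eleven]
    exact one_mul d
  have hfix : ¬ Function.IsFixedPt (8 * · : ZMod 623 → ZMod 623) d := fun hf => by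
    refine Finset.disjoint_left.mp disjoint_diffSet_baseBlock_Hblock hd ?_
    rw [mem_Hblock_iff]
    have hf' : 8 * d = d := hf
    linear_combination hf'
  have hmin : Function.minimalPeriod (8 * · : ZMod 623 → ZMod 623) d = 11 :=
    haveI : Fact (Nat.Prime 11) := ⟨by norm_num⟩
    Function.minimalPeriod_eq_prime hper hfix
  refine Fin.ext (Function.iterate_injOn_Iio_minimalPeriod (f := (8 * · : ZMod 623 → ZMod 623))
    (x := d) ?_ ?_ ?_)
  · simp [hmin]
  · simp [hmin]
  · simpa [mul_left_iterate] using h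

theorem diffSet_image_mul {u : ZMod 623} (hu : IsUnit u) (B : Finset (ZMod 623)) :
    diffSet (B.image (u * ·)) = (diffSet B).image (u * ·) := by
  ext x
  simp only [diffSet, Finset.mem_image, Finset.mem_filter, Finset.mem_product, Prod.exists]
  constructor
  · rintro ⟨_, _, ⟨⟨⟨a, ha, rfl⟩, b, hb, rfl⟩, hab⟩, rfl⟩
    exact ⟨a - b, ⟨a, b, ⟨⟨ha, hb⟩, fun h => hab (by simp only [h])⟩, rfl⟩, mul_sub u a b⟩
  · rintro ⟨_, ⟨a, b, ⟨⟨ha, hb⟩, hab⟩, rfl⟩, rfl⟩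
    exact ⟨u * a, u * b, ⟨⟨⟨a, ha, rfl⟩, b, hb, rfl⟩, fun h => hab (hu.mul_left_cancel h)⟩,
      (mul_sub u a b).symm⟩

theorem diffSet_dilate (i : Fin 11) :
    diffSet (dilate i) = (diffSet baseBlock).image ((8 : ZMod 623) ^ (i : ℕ) * ·) :=
  diffSet_image_mul (isUnit_eight_pow i) baseBlock

theorem card_diffSet_dilate (i : Fin 11) : (diffSet (dilate i)).card = 56 := by
  rw [diffSet_dilate, Finset.card_image_of_injective _ (isUnit_eight_pow i).mul_right_injective,
    card_diffSet_baseBlock]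

theorem disjoint_diffSet_dilate {i j : Fin 11} (hij : i ≠ j) :
    Disjoint (diffSet (dilate i)) (diffSet (dilate j)) := by
  have pow_eq (k : ℕ) (d : ZMod 623) : (8 ^ k * d) ^ 11 = d ^ 11 := by
    rw [mul_pow, ← pow_mul, mul_comm k, pow_mul, eight_pow_eleven, one_pow, one_mul]
  simp only [diffSet_dilate, Finset.disjoint_left, Finset.mem_image]
  rintro _ ⟨d, hd, rfl⟩ ⟨e, he, hde⟩
  have h : e = d := injOn_pow_eleven he hd <| by
    change e ^ 11 = d ^ 11
    rw [← pow_eq j e, hde, pow_eq i d]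
  subst h
  exact hij (eight_pow_mul_injective hd hde.symm)

theorem disjoint_diffSet_dilate_Hblock (i : Fin 11) :
    Disjoint (diffSet (dilate i)) Hblock := by
  simp only [diffSet_dilate, Finset.disjoint_left, Finset.mem_image]
  rintro _ ⟨d, hd, rfl⟩ h
  refine Finset.disjoint_left.mp disjoint_diffSet_baseBlock_Hblock hd ?_
  rw [mem_Hblock_iff] at h ⊢
  rwa [mul_left_comm, (isUnit_eight_pow i).mul_right_eq_zero] at h

theorem card_Hblock : Hblock.card = 7 := by
  decide +kernel

theorem biUnion_diffSet_dilate :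
    (Finset.univ.biUnion fun i => diffSet (dilate i)) = Hblockᶜ := by
  refine Finset.eq_of_subset_of_card_le ?_ ?_
  · refine Finset.biUnion_subset.mpr fun i _ => ?_
    exact Finset.subset_compl_iff_disjoint_right.mpr (disjoint_diffSet_dilate_Hblock i)
  · rw [Finset.card_biUnion fun i _ j _ hij => disjoint_diffSet_dilate hij]
    simp [card_diffSet_dilate, Finset.card_compl, card_Hblock, ZMod.card]

/-- `H` is a subgroup of `ℤ/623ℤ` of order `7`, and the eleven difference sets
`Δ(8ⁱ · B)`, `i = 0, …, 10`, are pairwise disjoint, each has cardinality `56`,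
each is disjoint from `H`, and their union together with `H \ {0}` is
`ℤ/623ℤ \ {0}`. -/
theorem one_rotational_difference_family_zmod_623_16 :
    (∃ S : AddSubgroup (ZMod 623), (S : Set (ZMod 623)) = (Hblock : Set (ZMod 623))) ∧
    Hblock.card = 7 ∧
    (∀ i j, i ≠ j → Disjoint (diffSet (dilate i)) (diffSet (dilate j))) ∧
    (∀ i, (diffSet (dilate i)).card = 56) ∧
    (∀ i, Disjoint (diffSet (dilate i)) Hblock) ∧
    (Hblock \ {0}) ∪ (Finset.univ.biUnion fun i => diffSet (dilate i)) =
      Finset.univ \ {0} := by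
  refine ⟨⟨(AddMonoidHom.mulLeft (7 : ZMod 623)).ker, ?_⟩, card_Hblock,
    fun _ _ => disjoint_diffSet_dilate, card_diffSet_dilate,
    disjoint_diffSet_dilate_Hblock, ?_⟩
  · ext x
    simp [AddMonoidHom.mem_ker, mem_Hblock_iff]
  · have h0 : (0 : ZMod 623) ∈ Hblock := by simp [Hblock]
    rw [biUnion_diffSet_dilate]
    ext x
    simp only [Finset.mem_union, Finset.mem_sdiff, Finset.mem_singleton, Finset.mem_compl,
      Finset.mem_univ, true_and]
    grind
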